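/- arXiv:2511.02579 — 2 statements merged into one kernel-verified Lean document; each statement's English description precedes it below -/
import Mathlib

section
/- Let N ≥ 3, let v be a smooth tangent vector field on S^(N−1) and f, H : S^(N−1) → ℝ smooth, satisfying div_S v = −(N−2)f, v·∇_S f = H, and v·∇_S H = 2fH on S^(N−1). Then ∫_{S^(N−1)} H² dS = (N−4) · ∫_{S^(N−1)} H f² dS. -/
open MeasureTheory Metric
open scoped RealInnerProductSpace

/-- The unit sphere of `ℝ^(n+1)` has finite `n`-dimensional Hausdorff measure. -/
theorem hausdorffMeasure_sphere_lt_top (n : ℕ) :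
    μH[(n : ℝ)] (sphere (0 : EuclideanSpace ℝ (Fin (n + 1))) 1) < ⊤ := by
  let A : Fin (n + 1) → ℝ → (Fin n → ℝ) → EuclideanSpace ℝ (Fin (n + 1)) :=
    fun i s y => WithLp.toLp 2 (i.insertNth s y)
  let F : Fin (n + 1) → ℝ → (Fin n → ℝ) → EuclideanSpace ℝ (Fin (n + 1)) :=
    fun i s y => ‖A i s y‖⁻¹ • A i s y
  let Q : Set (Fin n → ℝ) := Set.Icc (-1) 1
  have hA0 : ∀ i s y, s ≠ 0 → A i s y ≠ 0 := by
    intro i s y hs h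
    apply hs
    have := congrArg (fun x : EuclideanSpace ℝ (Fin (n + 1)) => x i) h
    simpa [A] using this
  have hAsmooth : ∀ i s, ContDiff ℝ 1 (A i s) := by
    intro i s
    rw [contDiff_euclidean]
    intro k
    refine Fin.succAboveCases i ?_ (fun j => ?_) k
    · simpa [A] using contDiff_const
    · simpa [A] using contDiff_apply ℝ ℝ j
  have hFlt : ∀ i s, s ≠ 0 → μH[(n : ℝ)] (F i s '' Q) < ⊤ := by
    intro i s hs
    have hF : ContDiff ℝ 1 (F i s) :=
      (((hAsmooth i s).norm ℝ (hA0 i s · hs)).inv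
        (fun y => norm_ne_zero_iff.mpr (hA0 i s y hs))).smul (hAsmooth i s)
    obtain ⟨K, hK⟩ := hF.contDiffOn.exists_lipschitzOnWith (s := Q) one_ne_zero
      (convex_Icc _ _) isCompact_Icc
    refine (hK.hausdorffMeasure_image_le n.cast_nonneg).trans_lt ?_
    have hvol : (μH[(n : ℝ)] : Measure (Fin n → ℝ)) = volume := by
      simpa using hausdorffMeasure_pi_real (ι := Fin n)
    rw [hvol]
    refine ENNReal.mul_lt_top ?_ isCompact_Icc.measure_lt_top
    exact ENNReal.rpow_lt_top_of_nonneg n.cast_nonneg ENNReal.coe_ne_top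
  have hcover : sphere (0 : EuclideanSpace ℝ (Fin (n + 1))) 1 ⊆
      ⋃ i, (F i 1 '' Q ∪ F i (-1) '' Q) := by
    intro x hx
    have hx1 : ‖x‖ = 1 := by simpa using hx
    obtain ⟨i, -, hi⟩ := Finset.exists_max_image Finset.univ (fun k => |x k|) Finset.univ_nonempty
    have hi0 : 0 < |x i| := by
      rcases (abs_nonneg (x i)).lt_or_eq with h | h
      · exact h
      · have : x = 0 := by
          ext k
          have := hi k (Finset.mem_univ k)
          rw [← h] at this
          simpa using this
        simp [this] at hx1
    have key : ∀ s : ℝ, x i = s * |x i| → x ∈ F i s '' Q := by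
      intro s hs
      refine ⟨fun j => |x i|⁻¹ * x (i.succAbove j), ?_, ?_⟩
      · have hle : ∀ j, |(|x i|⁻¹ * x (i.succAbove j))| ≤ 1 := by
          intro j
          rw [abs_mul, abs_inv, abs_abs, inv_mul_le_iff₀ hi0, mul_one]
          exact hi _ (Finset.mem_univ _)
        exact ⟨fun j => (abs_le.mp (hle j)).1, fun j => (abs_le.mp (hle j)).2⟩
      · have hAx : A i s (fun j => |x i|⁻¹ * x (i.succAbove j)) = |x i|⁻¹ • x := by
          ext k
          refine Fin.succAboveCases i ?_ (fun j => ?_) k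
          · simp only [A, Fin.insertNth_apply_same, PiLp.smul_apply, smul_eq_mul]
            rw [eq_inv_mul_iff_mul_eq₀ hi0.ne', mul_comm]
            exact hs.symm
          · simp [A]
        simp only [F, hAx]
        rw [norm_smul, hx1, norm_inv, Real.norm_eq_abs, abs_abs, mul_one, inv_inv, smul_smul,
          mul_inv_cancel₀ hi0.ne', one_smul]
    refine Set.mem_iUnion.mpr ⟨i, ?_⟩
    rcases abs_cases (x i) with ⟨h, -⟩ | ⟨h, -⟩
    · exact Or.inl (key 1 (by linarith))
    · exact Or.inr (key (-1) (by linarith))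
  refine (measure_mono hcover).trans_lt ((measure_iUnion_le _).trans_lt ?_)
  rw [tsum_fintype]
  refine ENNReal.sum_lt_top.mpr fun i _ => (measure_union_le _ _).trans_lt ?_
  exact ENNReal.add_lt_top.mpr ⟨hFlt i 1 one_ne_zero, hFlt i (-1) (by norm_num)⟩

/-- The infinitesimal rotation in the `(i, j)` coordinate plane. -/
noncomputable def planeRotationField {ι : Type*} [DecidableEq ι] [Fintype ι] (i j : ι) :
    EuclideanSpace ℝ ι →L[ℝ] EuclideanSpace ℝ ι :=
  (EuclideanSpace.proj j : EuclideanSpace ℝ ι →L[ℝ] ℝ).smulRight (EuclideanSpace.single i (1 : ℝ)) -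
    (EuclideanSpace.proj i : EuclideanSpace ℝ ι →L[ℝ] ℝ).smulRight
      (EuclideanSpace.single j (1 : ℝ))

theorem planeRotationField_apply {ι : Type*} [DecidableEq ι] [Fintype ι] (i j : ι)
    (x : EuclideanSpace ℝ ι) :
    planeRotationField i j x =
      x j • EuclideanSpace.single i (1 : ℝ) - x i • EuclideanSpace.single j (1 : ℝ) := by
  simp [planeRotationField]

/-- The rotation by angle `t` in the `(i, j)` coordinate plane. -/
noncomputable def planeRotation {ι : Type*} [DecidableEq ι] [Fintype ι] {i j : ι} (hij : i ≠ j)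
    (t : ℝ) : EuclideanSpace ℝ ι ≃ₗᵢ[ℝ] EuclideanSpace ℝ ι :=
  LinearIsometry.toLinearIsometryEquiv
    { toLinearMap := ((ContinuousLinearMap.id ℝ (EuclideanSpace ℝ ι) +
          Real.sin t • planeRotationField i j +
          (Real.cos t - 1) • -(planeRotationField i j ∘L planeRotationField i j) :
            EuclideanSpace ℝ ι →L[ℝ] EuclideanSpace ℝ ι) :
              EuclideanSpace ℝ ι →ₗ[ℝ] EuclideanSpace ℝ ι)
      norm_map' := by
        intro x
        rw [← sq_eq_sq₀ (norm_nonneg _) (norm_nonneg _), ← real_inner_self_eq_norm_sq,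
          ← real_inner_self_eq_norm_sq]
        simp [planeRotationField_apply, inner_add_left, inner_add_right, inner_sub_left,
          inner_sub_right, inner_smul_left, inner_smul_right, EuclideanSpace.inner_single_left,
          EuclideanSpace.inner_single_right, hij, hij.symm,
          -inner_self_eq_norm_sq_to_K]
        linear_combination (x i ^ 2 + x j ^ 2) * Real.sin_sq_add_cos_sq t }
    rfl

theorem planeRotation_apply {ι : Type*} [DecidableEq ι] [Fintype ι] {i j : ι} (hij : i ≠ j)
    (t : ℝ) (x : EuclideanSpace ℝ ι) :
    planeRotation hij t x = x + Real.sin t • planeRotationField i j x +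
      (Real.cos t - 1) • -(planeRotationField i j (planeRotationField i j x)) := rfl

theorem hasDerivAt_planeRotation {ι : Type*} [DecidableEq ι] [Fintype ι] {i j : ι} (hij : i ≠ j)
    (t : ℝ) (x : EuclideanSpace ℝ ι) :
    HasDerivAt (fun s => planeRotation hij s x) (Real.cos t • planeRotationField i j x +
      (-Real.sin t) • -(planeRotationField i j (planeRotationField i j x))) t := by
  simp only [planeRotation_apply]
  exact (((Real.hasDerivAt_sin t).smul_const (planeRotationField i j x)).const_add x).fun_add
    (((Real.hasDerivAt_cos t).sub_const 1).smul_const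
      (-(planeRotationField i j (planeRotationField i j x))))

theorem ContinuousOn.integrableOn_of_isCompact_of_measure_ne_top {X : Type*} [TopologicalSpace X]
    [T2Space X] [MeasurableSpace X] [BorelSpace X] {μ : Measure X} {s : Set X}
    {g : X → ℝ} (hg : ContinuousOn g s) (hs : IsCompact s) (hμ : μ s ≠ ⊤) :
    IntegrableOn g s μ := by
  obtain ⟨C, hC⟩ := hs.exists_bound_of_continuousOn hg
  exact IntegrableOn.of_bound hμ.lt_top
    (hg.aestronglyMeasurable_of_isCompact hs hs.measurableSet) C
    ((ae_restrict_iff' hs.measurableSet).mpr (.of_forall hC))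

/-- The derivative along an infinitesimal rotation integrates to zero over the sphere. -/
theorem integral_fderiv_planeRotationField {ι : Type*} [DecidableEq ι] [Fintype ι]
    {d : ℝ} (hfin : μH[d] (sphere (0 : EuclideanSpace ℝ ι) 1) ≠ ⊤)
    {g : EuclideanSpace ℝ ι → ℝ} (hg : ContDiffOn ℝ 1 g {0}ᶜ) (i j : ι) :
    ∫ x in sphere (0 : EuclideanSpace ℝ ι) 1, fderiv ℝ g x (planeRotationField i j x) ∂μH[d]
      = 0 := by
  rcases eq_or_ne i j with rfl | hij
  · simp [planeRotationField_apply]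
  set S := sphere (0 : EuclideanSpace ℝ ι) 1 with hS
  have hSc : IsCompact S := isCompact_sphere _ _
  have hS0 : S ⊆ {0}ᶜ := fun x hx h => by
    rw [Set.mem_singleton_iff] at h
    simp [hS, h] at hx
  have hRS : ∀ t, ∀ x ∈ S, planeRotation hij t x ∈ S := by
    intro t x hx
    simpa [hS] using hx
  have hgS : ContinuousOn g S := hg.continuousOn.mono hS0
  have hDg : ContinuousOn (fderiv ℝ g) S :=
    (hg.continuousOn_fderiv_of_isOpen isOpen_compl_singleton le_rfl).mono hS0
  obtain ⟨C, hC⟩ := hSc.exists_bound_of_continuousOn hDg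
  set R : EuclideanSpace ℝ ι →L[ℝ] EuclideanSpace ℝ ι := planeRotationField i j with hR
  let R' : ℝ → EuclideanSpace ℝ ι → EuclideanSpace ℝ ι := fun t x =>
    Real.cos t • R x + (-Real.sin t) • -(R (R x))
  have hR' : ∀ t, ∀ x ∈ S, ‖R' t x‖ ≤ ‖R‖ + ‖R‖ * ‖R‖ := by
    intro t x hx
    have hx1 : ‖x‖ = 1 := by simpa [hS] using hx
    have h1 : ‖R x‖ ≤ ‖R‖ := by simpa [hx1] using R.le_opNorm x
    have h2 : ‖R (R x)‖ ≤ ‖R‖ * ‖R‖ :=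
      (R.le_opNorm _).trans (mul_le_mul_of_nonneg_left h1 (norm_nonneg _))
    refine (norm_add_le _ _).trans (add_le_add ?_ ?_)
    · rw [norm_smul, Real.norm_eq_abs]
      exact (mul_le_of_le_one_left (norm_nonneg _) (Real.abs_cos_le_one t)).trans h1
    · rw [norm_smul, norm_neg, norm_neg, Real.norm_eq_abs]
      exact (mul_le_of_le_one_left (norm_nonneg _) (Real.abs_sin_le_one t)).trans h2
  have hcont0 : ContinuousOn (fun x => fderiv ℝ g x (R x)) S :=
    hDg.clm_apply R.continuous.continuousOn
  have hconst : ∀ t, ∫ x in S, g (planeRotation hij t x) ∂μH[d] = ∫ x in S, g x ∂μH[d] := by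
    intro t
    have hpre : planeRotation hij t ⁻¹' S = S := by
      ext x
      simp [hS]
    have := ((planeRotation hij t).toIsometryEquiv.measurePreserving_hausdorffMeasure
      d).setIntegral_preimage_emb
      (planeRotation hij t).toHomeomorph.measurableEmbedding g S
    have hpre' : (planeRotation hij t).toIsometryEquiv ⁻¹' S = S := hpre
    rw [hpre'] at this
    exact this
  have hder := hasDerivAt_integral_of_dominated_loc_of_deriv_le (μ := μH[d].restrict S)
    (F := fun t x => g (planeRotation hij t x))
    (F' := fun t x => fderiv ℝ g (planeRotation hij t x) (R' t x)) (x₀ := 0)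
    (bound := fun _ => C * (‖R‖ + ‖R‖ * ‖R‖)) (s := Set.univ) Filter.univ_mem
    (.of_forall fun t => (hgS.comp (planeRotation hij t).continuous.continuousOn
      (hRS t)).aestronglyMeasurable_of_isCompact hSc hSc.measurableSet)
    (ContinuousOn.integrableOn_of_isCompact_of_measure_ne_top
      (hgS.comp (planeRotation hij 0).continuous.continuousOn (hRS 0)) hSc hfin)
    (by
      simpa [R', planeRotation_apply] using
        hcont0.aestronglyMeasurable_of_isCompact hSc hSc.measurableSet)
    ((ae_restrict_iff' hSc.measurableSet).mpr (.of_forall fun x hx t _ =>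
      ((fderiv ℝ g _).le_opNorm _).trans (mul_le_mul (hC _ (hRS t x hx)) (hR' t x hx)
        (norm_nonneg _) ((norm_nonneg _).trans (hC x hx)))))
    (integrableOn_const hfin)
    ((ae_restrict_iff' hSc.measurableSet).mpr (.of_forall fun x hx t _ =>
      (((hg.differentiableOn one_ne_zero).differentiableAt
        (isOpen_compl_singleton.mem_nhds (hS0 (hRS t x hx)))).hasFDerivAt).comp_hasDerivAt t
          (hasDerivAt_planeRotation hij t x)))
  have h0 := hder.2
  simp only [hconst] at h0
  simpa [R', planeRotation_apply] using h0.unique (hasDerivAt_const _ _)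

/-- The divergence theorem on the unit sphere, for tangential `0`-homogeneous vector fields. -/
theorem integral_sphere_divergence_eq_zero {ι : Type*} [DecidableEq ι] [Fintype ι]
    {d : ℝ} (hfin : μH[d] (sphere (0 : EuclideanSpace ℝ ι) 1) ≠ ⊤)
    {X : EuclideanSpace ℝ ι → EuclideanSpace ℝ ι} (hX : ContDiffOn ℝ 1 X {0}ᶜ)
    (hhom : ∀ t : ℝ, 0 < t → ∀ x, x ≠ 0 → X (t • x) = X x)
    (htan : ∀ x, x ≠ 0 → ⟪X x, x⟫ = 0) :
    ∫ x in sphere (0 : EuclideanSpace ℝ ι) 1,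
      ∑ i, fderiv ℝ X x (EuclideanSpace.single i 1) i ∂μH[d] = 0 := by
  set S := sphere (0 : EuclideanSpace ℝ ι) 1 with hS
  have hSc : IsCompact S := isCompact_sphere _ _
  have hS0 : S ⊆ {0}ᶜ := fun x hx h => by
    rw [Set.mem_singleton_iff] at h
    simp [hS, h] at hx
  have hproj : ∀ i, ContDiff ℝ 1 (fun x : EuclideanSpace ℝ ι => x i) := fun i =>
    contDiff_euclidean.mp contDiff_id i
  have hg : ∀ i j, ContDiffOn ℝ 1 (fun x => X x i * x j) {0}ᶜ := fun i j =>
    ((hproj i).comp_contDiffOn hX).mul (hproj j).contDiffOn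
  have hint : ∀ i j, IntegrableOn
      (fun x => fderiv ℝ (fun x => X x i * x j) x (planeRotationField i j x)) S μH[d] :=
    fun i j => ContinuousOn.integrableOn_of_isCompact_of_measure_ne_top
      ((((hg i j).continuousOn_fderiv_of_isOpen isOpen_compl_singleton le_rfl).mono
        hS0).clm_apply (planeRotationField i j).continuous.continuousOn) hSc hfin
  have hpt : ∀ x ∈ S, ∑ i, fderiv ℝ X x (EuclideanSpace.single i 1) i =
      ∑ i, ∑ j, fderiv ℝ (fun x => X x i * x j) x (planeRotationField i j x) := by
    intro x hx
    have hx0 : x ≠ 0 := hS0 hx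
    have hXd : HasFDerivAt X (fderiv ℝ X x) x := ((hX.differentiableOn
      one_ne_zero).differentiableAt (isOpen_compl_singleton.mem_nhds hx0)).hasFDerivAt
    have hnorm : ∑ j, x j * x j = 1 := by
      have hx1 : ‖x‖ = 1 := by simpa [hS] using hx
      have := EuclideanSpace.real_norm_sq_eq x
      rw [hx1] at this
      simpa [sq] using this.symm
    have horth : ∑ i, X x i * x i = 0 := by
      simpa [PiLp.inner_apply, mul_comm] using htan x hx0
    have hradial : fderiv ℝ X x x = 0 := by
      have h1 : HasDerivAt (fun t : ℝ => X (t • x)) (fderiv ℝ X x x) 1 := by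
        have h2 : HasDerivAt (fun t : ℝ => t • x) x 1 := by
          simpa using (hasDerivAt_id (1 : ℝ)).smul_const x
        exact HasFDerivAt.comp_hasDerivAt (1 : ℝ) (by simpa using hXd) h2
      refine h1.unique ((hasDerivAt_const (1 : ℝ) (X x)).congr_of_eventuallyEq ?_)
      filter_upwards [lt_mem_nhds (zero_lt_one' ℝ)] with t ht using hhom t ht x hx0
    have hsum : ∑ j, x j • fderiv ℝ X x (EuclideanSpace.single j 1) = 0 := by
      simpa [map_sum, hradial] using
        congrArg (fderiv ℝ X x) ((EuclideanSpace.basisFun ι ℝ).sum_repr x)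
    have hsumi : ∀ i, ∑ j, x j * fderiv ℝ X x (EuclideanSpace.single j 1) i = 0 := by
      intro i
      simpa using congrArg (fun y : EuclideanSpace ℝ ι => y i) hsum
    have hterm : ∀ i j, fderiv ℝ (fun x => X x i * x j) x (planeRotationField i j x) =
        fderiv ℝ X x (EuclideanSpace.single i 1) i * (x j * x j)
          - x i * (x j * fderiv ℝ X x (EuclideanSpace.single j 1) i)
          + (if i = j then X x i * x j else 0) - X x i * x i := by
      intro i j
      have h1 : HasFDerivAt (fun y => X y i)
          ((EuclideanSpace.proj i : EuclideanSpace ℝ ι →L[ℝ] ℝ) ∘L fderiv ℝ X x) x :=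
        (EuclideanSpace.proj i : EuclideanSpace ℝ ι →L[ℝ] ℝ).hasFDerivAt.comp x hXd
      have h2 : HasFDerivAt (fun y : EuclideanSpace ℝ ι => y j)
          (EuclideanSpace.proj j : EuclideanSpace ℝ ι →L[ℝ] ℝ) x :=
        (EuclideanSpace.proj j : EuclideanSpace ℝ ι →L[ℝ] ℝ).hasFDerivAt
      rw [(h1.fun_mul h2).fderiv]
      rcases eq_or_ne i j with rfl | hij
      · simp [planeRotationField_apply]
        ring
      · simp [planeRotationField_apply, hij, hij.symm]
        ring
    simp only [hterm, Finset.sum_add_distrib, Finset.sum_sub_distrib, ← Finset.mul_sum, hnorm,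
      hsumi, Finset.sum_const, Finset.sum_ite_eq, Finset.mem_univ, if_true, horth]
    simp [mul_left_comm, ← Finset.mul_sum, horth]
  rw [setIntegral_congr_fun hSc.measurableSet hpt,
    integral_finsetSum _ fun i _ => integrable_finsetSum _ fun j _ => hint i j]
  refine Finset.sum_eq_zero fun i _ => ?_
  rw [integral_finsetSum _ fun j _ => hint i j]
  exact Finset.sum_eq_zero fun j _ => integral_fderiv_planeRotationField hfin (hg i j) i j

/-- `∫_{S^(N-1)} H² = (N-4) ∫_{S^(N-1)} H f²` for solutions of `div_S v = -(N-2)f`,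
`v·∇_S f = H`, `v·∇_S H = 2fH`.  Functions on `S^(N-1)` are encoded by `0`-homogeneous extensions to
`ℝ^N \ {0}`; then `div_S v (σ) = Σ_i ∂_i v^i (σ)` and `v·∇_S f (σ) = fderiv ℝ f σ (v σ)`. -/
theorem stmt_8 (N : ℕ) (hN : 3 ≤ N)
    (v : EuclideanSpace ℝ (Fin N) → EuclideanSpace ℝ (Fin N))
    (f H : EuclideanSpace ℝ (Fin N) → ℝ)
    (hv : ContDiffOn ℝ (⊤ : ℕ∞) v {(0 : EuclideanSpace ℝ (Fin N))}ᶜ)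
    (hf : ContDiffOn ℝ (⊤ : ℕ∞) f {(0 : EuclideanSpace ℝ (Fin N))}ᶜ)
    (hH : ContDiffOn ℝ (⊤ : ℕ∞) H {(0 : EuclideanSpace ℝ (Fin N))}ᶜ)
    (hvhom : ∀ t : ℝ, 0 < t → ∀ x : EuclideanSpace ℝ (Fin N), x ≠ 0 → v (t • x) = v x)
    (hfhom : ∀ t : ℝ, 0 < t → ∀ x : EuclideanSpace ℝ (Fin N), x ≠ 0 → f (t • x) = f x)
    (hHhom : ∀ t : ℝ, 0 < t → ∀ x : EuclideanSpace ℝ (Fin N), x ≠ 0 → H (t • x) = H x)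
    (htan : ∀ x : EuclideanSpace ℝ (Fin N), x ≠ 0 → ⟪v x, x⟫ = 0)
    (hdiv : ∀ σ ∈ sphere (0 : EuclideanSpace ℝ (Fin N)) 1,
      (∑ i, fderiv ℝ v σ (EuclideanSpace.single i 1) i) = -((N:ℝ) - 2) * f σ)
    (hnormal : ∀ σ ∈ sphere (0 : EuclideanSpace ℝ (Fin N)) 1,
      fderiv ℝ f σ (v σ) = H σ)
    (hbernoulli : ∀ σ ∈ sphere (0 : EuclideanSpace ℝ (Fin N)) 1,
      fderiv ℝ H σ (v σ) = 2 * f σ * H σ) :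
    ∫ σ in sphere (0 : EuclideanSpace ℝ (Fin N)) 1, (H σ) ^ 2 ∂μH[(N:ℝ) - 1]
      = ((N:ℝ) - 4) *
        ∫ σ in sphere (0 : EuclideanSpace ℝ (Fin N)) 1, H σ * (f σ) ^ 2 ∂μH[(N:ℝ) - 1] := by
  obtain ⟨n, rfl⟩ : ∃ n, N = n + 1 := ⟨N - 1, by omega⟩
  have hfin : μH[((n + 1 : ℕ) : ℝ) - 1] (sphere (0 : EuclideanSpace ℝ (Fin (n + 1))) 1) ≠ ⊤ := by
    simpa using (hausdorffMeasure_sphere_lt_top n).ne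
  set S := sphere (0 : EuclideanSpace ℝ (Fin (n + 1))) 1 with hS
  have hSc : IsCompact S := isCompact_sphere _ _
  have hS0 : S ⊆ {0}ᶜ := fun x hx h => by
    rw [Set.mem_singleton_iff] at h
    simp [hS, h] at hx
  have hle : ((1 : ℕ∞) : WithTop ℕ∞) ≤ ((⊤ : ℕ∞) : WithTop ℕ∞) := by exact_mod_cast le_top
  have hv1 : ContDiffOn ℝ 1 v {0}ᶜ := hv.of_le hle
  have hf1 : ContDiffOn ℝ 1 f {0}ᶜ := hf.of_le hle
  have hH1 : ContDiffOn ℝ 1 H {0}ᶜ := hH.of_le hle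
  have hzero := integral_sphere_divergence_eq_zero hfin
    (X := fun x => (H x * f x) • v x) ((hH1.mul hf1).smul hv1)
    (fun t ht x hx => by simp only [hvhom t ht x hx, hfhom t ht x hx, hHhom t ht x hx])
    (fun x hx => by rw [inner_smul_left, htan x hx, mul_zero])
  have hpt : ∀ x ∈ S, ∑ i, fderiv ℝ (fun x => (H x * f x) • v x) x
      (EuclideanSpace.single i 1) i =
        H x ^ 2 - (((n + 1 : ℕ) : ℝ) - 4) * (H x * f x ^ 2) := by
    intro x hx
    have hnhds : ({0}ᶜ : Set (EuclideanSpace ℝ (Fin (n + 1)))) ∈ nhds x :=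
      isOpen_compl_singleton.mem_nhds (hS0 hx)
    have hvd := ((hv1.differentiableOn one_ne_zero).differentiableAt hnhds).hasFDerivAt
    have hfd := ((hf1.differentiableOn one_ne_zero).differentiableAt hnhds).hasFDerivAt
    have hHd := ((hH1.differentiableOn one_ne_zero).differentiableAt hnhds).hasFDerivAt
    have hexp : ∀ L : EuclideanSpace ℝ (Fin (n + 1)) →L[ℝ] ℝ,
        ∑ i, L (EuclideanSpace.single i 1) * v x i = L (v x) := by
      intro L
      simpa [map_sum, mul_comm] using congrArg L ((EuclideanSpace.basisFun _ ℝ).sum_repr (v x))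
    rw [((hHd.fun_mul hfd).fun_smul hvd).fderiv]
    have hsplit : ∀ i, (((H x * f x) • fderiv ℝ v x +
        (H x • fderiv ℝ f x + f x • fderiv ℝ H x).smulRight (v x))
          (EuclideanSpace.single i 1)) i =
        (H x * f x) * fderiv ℝ v x (EuclideanSpace.single i 1) i +
          (H x • fderiv ℝ f x + f x • fderiv ℝ H x) (EuclideanSpace.single i 1) * v x i := by
      intro i
      simp
    simp only [hsplit, Finset.sum_add_distrib, ← Finset.mul_sum, hexp, hdiv x hx]
    simp only [_root_.add_apply, _root_.smul_apply, smul_eq_mul,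
      hnormal x hx, hbernoulli x hx]
    ring
  have hHc : ContinuousOn H S := hH1.continuousOn.mono hS0
  have hfc : ContinuousOn f S := hf1.continuousOn.mono hS0
  have hint1 : IntegrableOn (fun x => H x ^ 2) S μH[((n + 1 : ℕ) : ℝ) - 1] :=
    (hHc.pow 2).integrableOn_of_isCompact_of_measure_ne_top hSc hfin
  have hint2 : IntegrableOn (fun x => H x * f x ^ 2) S μH[((n + 1 : ℕ) : ℝ) - 1] :=
    (hHc.mul (hfc.pow 2)).integrableOn_of_isCompact_of_measure_ne_top hSc hfin
  rw [setIntegral_congr_fun hSc.measurableSet hpt, integral_sub hint1 (hint2.const_mul _),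
    integral_const_mul] at hzero
  exact sub_eq_zero.mp hzero
end

section
/- Let v be a smooth tangent vector field on S⁴ and f, p : S⁴ → ℝ smooth, satisfying the system: div_S v = −3f, v·∇_S f = H, and v·∇_S H = 2fH on S⁴, where H = |v|² + f² + 2p. Then ∫_{S⁴} (|v|² + 2p)² dS = 0, i.e. |v|² + 2p = 0 identically, and consequently f = 0 identically on S⁴. -/
open MeasureTheory Metric
open scoped RealInnerProductSpace

/-- The integral of the divergence of a compactly supported `C¹` vector field vanishes. -/
theorem integral_divergence_eq_zero {n : ℕ}
    {F : EuclideanSpace ℝ (Fin n) → EuclideanSpace ℝ (Fin n)}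
    (hF : ContDiff ℝ 1 F) (hc : HasCompactSupport F) :
    ∫ x, ∑ i, fderiv ℝ F x (EuclideanSpace.single i 1) i = 0 := by
  have hcoord (i : Fin n) (x : EuclideanSpace ℝ (Fin n)) (u : EuclideanSpace ℝ (Fin n)) :
      fderiv ℝ (fun y ↦ F y i) x u = fderiv ℝ F x u i := by
    have h := ((EuclideanSpace.proj (𝕜 := ℝ) i).hasFDerivAt.comp x
      (hF.differentiable (by norm_num) x).hasFDerivAt).fderiv
    exact DFunLike.congr_fun h u
  have hcont (i : Fin n) : Continuous fun x ↦ fderiv ℝ F x (EuclideanSpace.single i 1) i :=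
    (EuclideanSpace.proj (𝕜 := ℝ) i).continuous.comp
      ((hF.continuous_fderiv (by norm_num)).clm_apply continuous_const)
  have hint (i : Fin n) :
      Integrable fun x ↦ fderiv ℝ F x (EuclideanSpace.single i 1) i :=
    (hcont i).integrable_of_hasCompactSupport
      ((hc.fderiv ℝ).comp_left (g := fun L : EuclideanSpace ℝ (Fin n) →L[ℝ]
        EuclideanSpace ℝ (Fin n) ↦ L (EuclideanSpace.single i 1) i) (by simp))
  rw [integral_finsetSum _ fun i _ ↦ hint i]
  refine Finset.sum_eq_zero fun i _ ↦ ?_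
  have hFi : ContDiff ℝ 1 fun y ↦ F y i := (EuclideanSpace.proj (𝕜 := ℝ) i).contDiff.comp hF
  have hFint : Integrable fun y ↦ F y i :=
    hFi.continuous.integrable_of_hasCompactSupport
      (hc.comp_left (g := fun z : EuclideanSpace ℝ (Fin n) ↦ z i) (by simp))
  have h := integral_mul_fderiv_eq_neg_fderiv_mul_of_integrable (μ := volume)
    (f := fun _ ↦ (1 : ℝ)) (g := fun y ↦ F y i) (v := EuclideanSpace.single i 1)
    (by simp) (by simpa [hcoord] using hint i) (by simpa using hFint)
    (fun x _ ↦ differentiableAt_const _) (fun x _ ↦ hFi.differentiable (by norm_num) x)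
  simpa [hcoord] using h

/-- The product rule for the divergence of `h • v`. -/
theorem divergence_smul {n : ℕ} {h : EuclideanSpace ℝ (Fin n) → ℝ}
    {v : EuclideanSpace ℝ (Fin n) → EuclideanSpace ℝ (Fin n)} {x : EuclideanSpace ℝ (Fin n)}
    (hh : DifferentiableAt ℝ h x) (hv : DifferentiableAt ℝ v x) :
    ∑ i, fderiv ℝ (fun y ↦ h y • v y) x (EuclideanSpace.single i 1) i =
      fderiv ℝ h x (v x) + h x * ∑ i, fderiv ℝ v x (EuclideanSpace.single i 1) i := by
  have hsum : ∑ i, fderiv ℝ h x (EuclideanSpace.single i 1) * v x i = fderiv ℝ h x (v x) := by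
    have hvx : v x = ∑ i, v x i • EuclideanSpace.single i (1 : ℝ) := by
      simpa using ((EuclideanSpace.basisFun (Fin n) ℝ).sum_repr (v x)).symm
    conv_rhs => rw [hvx, map_sum]
    simp [mul_comm]
  rw [fderiv_fun_smul hh hv, ← hsum, Finset.mul_sum, ← Finset.sum_add_distrib]
  refine Finset.sum_congr rfl fun i _ ↦ ?_
  simp [add_comm]

/-- On `ℝⁿ \ {0}`, if `v` is tangent to the spheres centred at the origin and the divergence of
`g • v` is nonnegative, then this divergence vanishes on the unit sphere. -/
theorem divergence_eq_zero_on_sphere_of_nonneg {n : ℕ}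
    {v : EuclideanSpace ℝ (Fin n) → EuclideanSpace ℝ (Fin n)} {g : EuclideanSpace ℝ (Fin n) → ℝ}
    (hv : ContDiffOn ℝ 1 v {0}ᶜ) (hg : ContDiffOn ℝ 1 g {0}ᶜ)
    (htan : ∀ x, x ≠ 0 → ⟪v x, x⟫ = 0)
    (hnonneg : ∀ x, x ≠ 0 →
      0 ≤ fderiv ℝ g x (v x) + g x * ∑ i, fderiv ℝ v x (EuclideanSpace.single i 1) i)
    {σ : EuclideanSpace ℝ (Fin n)} (hσ : σ ∈ sphere (0 : EuclideanSpace ℝ (Fin n)) 1) :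
    fderiv ℝ g σ (v σ) + g σ * ∑ i, fderiv ℝ v σ (EuclideanSpace.single i 1) i = 0 := by
  let b : ContDiffBump (1 : ℝ) := ⟨1 / 4, 1 / 2, by norm_num, by norm_num⟩
  let φ : EuclideanSpace ℝ (Fin n) → ℝ := fun x ↦ b (‖x‖ ^ 2)
  have hφ : ContDiff ℝ 1 φ := b.contDiff.comp (contDiff_norm_sq ℝ)
  have hopen : IsOpen ({0}ᶜ : Set (EuclideanSpace ℝ (Fin n))) := isOpen_compl_singleton
  have hφ0 : φ =ᶠ[nhds 0] 0 := by
    have hb : (b : ℝ → ℝ) =ᶠ[nhds 0] 0 := by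
      rw [← notMem_tsupport_iff_eventuallyEq, b.tsupport_eq]
      simp [b, Real.dist_eq]
      norm_num
    have ht : Filter.Tendsto (fun x : EuclideanSpace ℝ (Fin n) ↦ ‖x‖ ^ 2) (nhds 0) (nhds 0) := by
      have h : Continuous fun x : EuclideanSpace ℝ (Fin n) ↦ ‖x‖ ^ 2 := by fun_prop
      simpa using h.tendsto 0
    exact ht.eventually hb
  let F : EuclideanSpace ℝ (Fin n) → EuclideanSpace ℝ (Fin n) := fun x ↦ (φ x * g x) • v x
  have hF : ContDiff ℝ 1 F := by
    rw [contDiff_iff_contDiffAt]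
    intro x
    by_cases hx : x = 0
    · subst hx
      refine (contDiffAt_const (c := (0 : EuclideanSpace ℝ (Fin n)))).congr_of_eventuallyEq ?_
      filter_upwards [hφ0] with y hy
      simp [F, hy]
    · have hmem := hopen.mem_nhds (show x ∈ ({0}ᶜ : Set _) from hx)
      exact (hφ.contDiffAt.mul (hg.contDiffAt hmem)).smul (hv.contDiffAt hmem)
  have hc : HasCompactSupport F := by
    refine HasCompactSupport.intro (isCompact_closedBall 0 2) fun x hx ↦ ?_
    have hx' : 2 < ‖x‖ := by simpa using hx
    have : φ x = 0 := by
      refine b.zero_of_le_dist ?_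
      rw [Real.dist_eq, abs_of_nonneg (by nlinarith)]
      simp only [b]
      nlinarith
    simp [F, this]
  have hdivF (x : EuclideanSpace ℝ (Fin n)) :
      ∑ i, fderiv ℝ F x (EuclideanSpace.single i 1) i = φ x *
        (fderiv ℝ g x (v x) + g x * ∑ i, fderiv ℝ v x (EuclideanSpace.single i 1) i) := by
    by_cases hx : x = 0
    · subst hx
      have hF0 : F =ᶠ[nhds 0] fun _ ↦ 0 := by
        filter_upwards [hφ0] with y hy
        simp [F, hy]
      simp [hF0.fderiv_eq, hφ0.eq_of_nhds]
    have hmem := hopen.mem_nhds (show x ∈ ({0}ᶜ : Set _) from hx)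
    have hgd := (hg.contDiffAt hmem).differentiableAt (by norm_num)
    have hvd := (hv.contDiffAt hmem).differentiableAt (by norm_num)
    have hφd := hφ.differentiable (by norm_num) x
    have hφv : fderiv ℝ φ x (v x) = 0 := by
      have hbd : DifferentiableAt ℝ b (‖x‖ ^ 2) :=
        (b.contDiff (n := 1)).differentiable (by norm_num) _
      have hd := (hbd.hasDerivAt.comp_hasFDerivAt x
        (hasStrictFDerivAt_norm_sq x).hasFDerivAt).fderiv
      rw [show φ = b ∘ fun y ↦ ‖y‖ ^ 2 from rfl, hd]
      simp [inner_eq_zero_symm.1 (htan x hx)]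
    have hprod := divergence_smul (hφd.mul hgd) hvd
    simp only [Pi.mul_apply] at hprod
    rw [show F = fun y ↦ (φ y * g y) • v y from rfl, hprod, fderiv_mul hφd hgd]
    simp only [add_apply, smul_apply, smul_eq_mul, hφv]
    ring
  have hcont : Continuous fun x ↦ ∑ i, fderiv ℝ F x (EuclideanSpace.single i 1) i :=
    continuous_finsetSum _ fun i _ ↦ (EuclideanSpace.proj (𝕜 := ℝ) i).continuous.comp
      ((hF.continuous_fderiv (by norm_num)).clm_apply continuous_const)
  have hpos : 0 ≤ fun x ↦ ∑ i, fderiv ℝ F x (EuclideanSpace.single i 1) i := by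
    intro x
    simp only [hdivF, Pi.zero_apply]
    by_cases hx : x = 0
    · simp [hx, hφ0.eq_of_nhds]
    · exact mul_nonneg b.nonneg (hnonneg x hx)
  have hint : Integrable fun x ↦ ∑ i, fderiv ℝ F x (EuclideanSpace.single i 1) i :=
    hcont.integrable_of_hasCompactSupport ((hc.fderiv ℝ).comp_left
      (g := fun L : EuclideanSpace ℝ (Fin n) →L[ℝ] EuclideanSpace ℝ (Fin n) ↦ ∑ i, L (EuclideanSpace.single i 1) i) (by simp))
  have hae := (integral_eq_zero_iff_of_nonneg hpos hint).1 (integral_divergence_eq_zero hF hc)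
  have hzero := congrFun ((hcont.ae_eq_iff_eq volume continuous_zero).1 hae) σ
  have hφσ : φ σ = 1 := by
    refine b.one_of_mem_closedBall ?_
    have : ‖σ‖ = 1 := by simpa using hσ
    simp [this, b]
  simpa [hdivF, hφσ] using hzero

/-- The derivative of a positively `0`-homogeneous map is positively `(-1)`-homogeneous. -/
theorem fderiv_eq_norm_inv_smul_of_homogeneous {E F : Type*} [NormedAddCommGroup E]
    [NormedSpace ℝ E] [NormedAddCommGroup F] [NormedSpace ℝ F] {g : E → F}
    (hg : ∀ t : ℝ, 0 < t → ∀ x : E, x ≠ 0 → g (t • x) = g x) {x : E} (hx : x ≠ 0) :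
    fderiv ℝ g x = ‖x‖⁻¹ • fderiv ℝ g (‖x‖⁻¹ • x) := by
  rw [← fderiv_comp_smul]
  refine Filter.EventuallyEq.fderiv_eq ?_
  filter_upwards [isOpen_compl_singleton.mem_nhds hx] with y hy
  exact (hg _ (inv_pos.2 (norm_pos_iff.2 hx)) y hy).symm

/-- Classification of homogeneous degree `-1` Euler solutions in `ℝ⁵`: on `S⁴` the
system `div_S v = -3f`, `v·∇_S f = H`, `v·∇_S H = 2fH` with `H = |v|² + f² + 2p`
forces `|v|² + 2p = 0` and `f = 0`.  Functions on `S⁴` are encoded by `0`-homogeneous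
extensions to `ℝ⁵ \ {0}`; `div_S v (σ) = Σ_i ∂_i v^i (σ)`, `v·∇_S g (σ) = fderiv ℝ g σ (v σ)`. -/
theorem stmt_9
    (v : EuclideanSpace ℝ (Fin 5) → EuclideanSpace ℝ (Fin 5))
    (f p H : EuclideanSpace ℝ (Fin 5) → ℝ)
    (hv : ContDiffOn ℝ (⊤ : ℕ∞) v {(0 : EuclideanSpace ℝ (Fin 5))}ᶜ)
    (hf : ContDiffOn ℝ (⊤ : ℕ∞) f {(0 : EuclideanSpace ℝ (Fin 5))}ᶜ)
    (hp : ContDiffOn ℝ (⊤ : ℕ∞) p {(0 : EuclideanSpace ℝ (Fin 5))}ᶜ)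
    (hvhom : ∀ t : ℝ, 0 < t → ∀ x : EuclideanSpace ℝ (Fin 5), x ≠ 0 → v (t • x) = v x)
    (hfhom : ∀ t : ℝ, 0 < t → ∀ x : EuclideanSpace ℝ (Fin 5), x ≠ 0 → f (t • x) = f x)
    (hphom : ∀ t : ℝ, 0 < t → ∀ x : EuclideanSpace ℝ (Fin 5), x ≠ 0 → p (t • x) = p x)
    (htan : ∀ x : EuclideanSpace ℝ (Fin 5), x ≠ 0 → ⟪v x, x⟫ = 0)
    (hH : ∀ x : EuclideanSpace ℝ (Fin 5), H x = ‖v x‖ ^ 2 + (f x) ^ 2 + 2 * p x)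
    (hdiv : ∀ σ ∈ sphere (0 : EuclideanSpace ℝ (Fin 5)) 1,
      (∑ i, fderiv ℝ v σ (EuclideanSpace.single i 1) i) = -3 * f σ)
    (hnormal : ∀ σ ∈ sphere (0 : EuclideanSpace ℝ (Fin 5)) 1,
      fderiv ℝ f σ (v σ) = H σ)
    (hbernoulli : ∀ σ ∈ sphere (0 : EuclideanSpace ℝ (Fin 5)) 1,
      fderiv ℝ H σ (v σ) = 2 * f σ * H σ) :
    (∫ σ in sphere (0 : EuclideanSpace ℝ (Fin 5)) 1,
        (‖v σ‖ ^ 2 + 2 * p σ) ^ 2 ∂μH[(4:ℝ)]) = 0 ∧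
      (∀ σ ∈ sphere (0 : EuclideanSpace ℝ (Fin 5)) 1, ‖v σ‖ ^ 2 + 2 * p σ = 0) ∧
      (∀ σ ∈ sphere (0 : EuclideanSpace ℝ (Fin 5)) 1, f σ = 0) := by
  have hcompl {σ : EuclideanSpace ℝ (Fin 5)}
      (hσ : σ ∈ sphere (0 : EuclideanSpace ℝ (Fin 5)) 1) : σ ≠ 0 := by
    rintro rfl
    simp at hσ
  have hproj {x : EuclideanSpace ℝ (Fin 5)} (hx : x ≠ 0) :
      ‖x‖⁻¹ • x ∈ sphere (0 : EuclideanSpace ℝ (Fin 5)) 1 := by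
    simp [norm_smul, hx]
  have hHsmooth : ContDiffOn ℝ (⊤ : ℕ∞) H {(0 : EuclideanSpace ℝ (Fin 5))}ᶜ := by
    rw [funext hH]
    exact ((hv.norm_sq ℝ).add (hf.pow 2)).add (contDiffOn_const.mul hp)
  have hHhom : ∀ t : ℝ, 0 < t → ∀ x : EuclideanSpace ℝ (Fin 5), x ≠ 0 → H (t • x) = H x := by
    intro t ht x hx
    rw [hH, hH, hvhom t ht x hx, hfhom t ht x hx, hphom t ht x hx]
  have hdiv' {x : EuclideanSpace ℝ (Fin 5)} (hx : x ≠ 0) :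
      (∑ i, fderiv ℝ v x (EuclideanSpace.single i 1) i) = ‖x‖⁻¹ * (-3 * f x) := by
    have hr := inv_pos.2 (norm_pos_iff.2 hx)
    have h := hdiv _ (hproj hx)
    rw [hfhom _ hr x hx] at h
    rw [fderiv_eq_norm_inv_smul_of_homogeneous hvhom hx, ← h, Finset.mul_sum]
    simp
  have hnormal' {x : EuclideanSpace ℝ (Fin 5)} (hx : x ≠ 0) :
      fderiv ℝ f x (v x) = ‖x‖⁻¹ * H x := by
    have hr := inv_pos.2 (norm_pos_iff.2 hx)
    have h := hnormal _ (hproj hx)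
    rw [hvhom _ hr x hx, hHhom _ hr x hx] at h
    rw [fderiv_eq_norm_inv_smul_of_homogeneous hfhom hx, ← h]
    simp
  have hbernoulli' {x : EuclideanSpace ℝ (Fin 5)} (hx : x ≠ 0) :
      fderiv ℝ H x (v x) = ‖x‖⁻¹ * (2 * f x * H x) := by
    have hr := inv_pos.2 (norm_pos_iff.2 hx)
    have h := hbernoulli _ (hproj hx)
    rw [hvhom _ hr x hx, hHhom _ hr x hx, hfhom _ hr x hx] at h
    rw [fderiv_eq_norm_inv_smul_of_homogeneous hHhom hx, ← h]
    simp
  have hdf {x : EuclideanSpace ℝ (Fin 5)} (hx : x ≠ 0) : HasFDerivAt f (fderiv ℝ f x) x :=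
    ((hf.contDiffAt (isOpen_compl_singleton.mem_nhds hx)).differentiableAt (by simp)).hasFDerivAt
  have hdH {x : EuclideanSpace ℝ (Fin 5)} (hx : x ≠ 0) : HasFDerivAt H (fderiv ℝ H x) x :=
    ((hHsmooth.contDiffAt (isOpen_compl_singleton.mem_nhds hx)).differentiableAt
      (by simp)).hasFDerivAt
  have hv1 := hv.of_le (m := 1) (by simp)
  have hf1 := hf.of_le (m := 1) (by simp)
  have hH1 := hHsmooth.of_le (m := 1) (by simp)
  -- `div ((f H - f³ / 3) v) = |x|⁻¹ (H - f²)²`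
  let g : EuclideanSpace ℝ (Fin 5) → ℝ := fun x ↦ f x * H x - 1 / 3 * f x ^ 3
  have hgdiv {x : EuclideanSpace ℝ (Fin 5)} (hx : x ≠ 0) :
      fderiv ℝ g x (v x) + g x * ∑ i, fderiv ℝ v x (EuclideanSpace.single i 1) i
        = ‖x‖⁻¹ * (‖v x‖ ^ 2 + 2 * p x) ^ 2 := by
    have hg : fderiv ℝ g x = _ :=
      (((hdf hx).mul (hdH hx)).sub (((hdf hx).pow 3).const_mul (1 / 3))).fderiv
    have hw : ‖v x‖ ^ 2 + 2 * p x = H x - f x ^ 2 := by rw [hH]; ring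
    rw [hg, hdiv' hx, hw]
    simp [hnormal' hx, hbernoulli' hx, g]
    ring
  have hw : ∀ σ ∈ sphere (0 : EuclideanSpace ℝ (Fin 5)) 1, ‖v σ‖ ^ 2 + 2 * p σ = 0 := by
    intro σ hσ
    have h := divergence_eq_zero_on_sphere_of_nonneg (g := g) hv1
      ((hf1.mul hH1).sub (contDiffOn_const.mul (hf1.pow 3))) htan
      (fun x hx ↦ by rw [hgdiv hx]; positivity) hσ
    have h' := (hgdiv (hcompl hσ)).symm.trans h
    simpa [hcompl hσ] using h'
  have hHf {x : EuclideanSpace ℝ (Fin 5)} (hx : x ≠ 0) : H x = f x ^ 2 := by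
    have hr := inv_pos.2 (norm_pos_iff.2 hx)
    have h := hw _ (hproj hx)
    rw [hvhom _ hr x hx, hphom _ hr x hx] at h
    rw [hH]
    linarith
  -- `div (-f v) = 2 |x|⁻¹ f²`
  have hfdiv {x : EuclideanSpace ℝ (Fin 5)} (hx : x ≠ 0) :
      fderiv ℝ (fun y ↦ -f y) x (v x)
        + (-f x) * ∑ i, fderiv ℝ v x (EuclideanSpace.single i 1) i = ‖x‖⁻¹ * (2 * f x ^ 2) := by
    rw [(hdf hx).fun_neg.fderiv, hdiv' hx, neg_apply, hnormal' hx, hHf hx]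
    ring
  refine ⟨?_, hw, ?_⟩
  · rw [setIntegral_congr_fun (g := fun _ ↦ 0) isClosed_sphere.measurableSet
      fun σ hσ ↦ by simp [hw σ hσ]]
    simp
  · intro σ hσ
    have h := divergence_eq_zero_on_sphere_of_nonneg (g := fun y ↦ -f y) hv1 hf1.neg htan
      (fun x hx ↦ by rw [hfdiv hx]; positivity) hσ
    have h' := (hfdiv (hcompl hσ)).symm.trans h
    simpa [hcompl hσ] using h'
end
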